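/- arXiv:2212.08176 — 2 statements merged into one kernel-verified Lean document; each statement's English description precedes it below -/
import Mathlib

section
/- Let S ⊂ (0,T) be a closed set with upper Minkowski dimension at most γ < 1, i.e. H¹((S)_δ) ≤ C δ^{1−γ} for all small δ, where (S)_δ is the δ-neighbourhood. Then for every δ > 0 small there exists η_δ ∈ C^∞([0,T]) with η_δ ≡ 1 on (S)_δ, η_δ ≡ 0 outside (S)_{2δ}, 0 ≤ η_δ ≤ 1, and for every α ∈ (0,1), q ∈ (1,∞): ‖η_δ‖_{W^{α,q}([0,T])} ≤ C' δ^{(1−γ)/q − α}. -/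
open MeasureTheory Set
open scoped ENNReal Topology

noncomputable section

/-- The `δ`-neighbourhood of a set of times. -/
def tNbhd (S : Set ℝ) (δ : ℝ) : Set ℝ := {t | ∃ s ∈ S, |t - s| ≤ δ}

/-- The Gagliardo (fractional Sobolev) `W^{α,q}` norm of `η` on `[0,T]`,
namely `‖η‖_{L^q([0,T])} + [η]_{W^{α,q}([0,T])}`. -/
def WNorm (T α q : ℝ) (η : ℝ → ℝ) : ℝ≥0∞ :=
  (∫⁻ t in Icc (0:ℝ) T, ENNReal.ofReal (|η t| ^ q)) ^ (1 / q)
    + (∫⁻ z in (Icc (0:ℝ) T) ×ˢ (Icc (0:ℝ) T),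
        ENNReal.ofReal (|η z.1 - η z.2| ^ q / |z.1 - z.2| ^ (1 + α * q))) ^ (1 / q)

lemma tNbhd_closed {S : Set ℝ} (hS : IsClosed S) {δ : ℝ} (hδ : 0 ≤ δ) : IsClosed (tNbhd S δ) := by
  have : tNbhd S δ = Metric.cthickening δ S := by
    rw [hS.cthickening_eq_biUnion_closedBall hδ]
    ext t
    simp [tNbhd, Real.dist_eq]
  rw [this]
  exact Metric.isClosed_cthickening

def kerH (K α q u : ℝ) : ℝ := (min 1 (K * |u|)) ^ q / |u| ^ (1 + α * q)

lemma kerH_nonneg {K α q u : ℝ} (hK : 0 < K) : 0 ≤ kerH K α q u := by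
  unfold kerH
  have : 0 ≤ min 1 (K * |u|) := le_min zero_le_one (by positivity)
  positivity

lemma kerH_meas (K α q : ℝ) : Measurable (kerH K α q) := by
  unfold kerH
  fun_prop

lemma kerH_int {K α q : ℝ} (hK : 0 < K) (hα : α ∈ Ioo (0:ℝ) 1) (hq : 1 < q) :
    Integrable (kerH K α q) := by
  obtain ⟨h0, h1⟩ := hα
  let f : ℝ → ℝ := fun r => (min 1 (K * r)) ^ q / r ^ (1 + α * q)
  have hf : kerH K α q = fun x => f ‖x‖ := by
    funext x; simp [kerH, f]
  have hfm : Measurable f := by fun_prop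
  rw [hf, integrable_fun_norm_addHaar]
  simp only [Module.finrank_self, le_refl, tsub_eq_zero_of_le, pow_zero, one_smul]
  rw [← Ioc_union_Ioi_eq_Ioi (zero_le_one), integrableOn_union]
  constructor
  · have h := (intervalIntegral.intervalIntegrable_rpow' (a := 0) (b := 1)
      (r := q - (1 + α * q)) (by nlinarith)).1.const_mul (K ^ q)
    refine Integrable.mono' h hfm.aestronglyMeasurable ?_
    filter_upwards [ae_restrict_mem measurableSet_Ioc] with r hr
    have hr0 : 0 < r := hr.1
    have hm : 0 ≤ min 1 (K * r) := le_min zero_le_one (by positivity)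
    rw [Real.norm_of_nonneg (by positivity), Real.rpow_sub hr0, ← mul_div_assoc,
      ← Real.mul_rpow hK.le hr0.le]
    simp only [f]
    gcongr
    exact min_le_right _ _
  · have h := integrableOn_Ioi_rpow_of_lt (a := -(1 + α * q)) (by nlinarith) one_pos
    refine Integrable.mono' h hfm.aestronglyMeasurable ?_
    filter_upwards [ae_restrict_mem measurableSet_Ioi] with r hr
    have hr0 : 0 < r := zero_lt_one.trans hr
    have hm : 0 ≤ min 1 (K * r) := le_min zero_le_one (by positivity)
    rw [Real.norm_of_nonneg (by positivity), Real.rpow_neg hr0.le, ← one_div]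
    simp only [f]
    gcongr
    exact Real.rpow_le_one hm (min_le_left _ _) (by linarith)

lemma kerH_scale {K α q δ : ℝ} (hK : 0 < K) (hα : α ∈ Ioo (0:ℝ) 1) (hq : 1 < q) (hδ : 0 < δ) :
    ∫⁻ u, ENNReal.ofReal (kerH (K / δ) α q u)
      = ENNReal.ofReal (δ ^ (-(α * q)) * ∫ u, kerH K α q u) := by
  have hKd : 0 < K / δ := by positivity
  rw [← ofReal_integral_eq_lintegral_ofReal (kerH_int hKd hα hq)
    (Filter.Eventually.of_forall fun u => kerH_nonneg hKd)]
  congr 1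
  have : ∀ u, kerH (K / δ) α q u = δ ^ (-(1 + α * q)) * kerH K α q (u / δ) := by
    intro u
    unfold kerH
    rw [abs_div, abs_of_pos hδ, Real.div_rpow (abs_nonneg _) hδ.le, Real.rpow_neg hδ.le]
    have : δ ^ (1 + α * q) ≠ 0 := by positivity
    rw [show K / δ * |u| = K * (|u| / δ) by ring]
    field_simp
  simp_rw [this]
  rw [integral_const_mul, Measure.integral_comp_div, abs_of_pos hδ, smul_eq_mul, ← mul_assoc]
  congr 1
  rw [← Real.rpow_add_one hδ.ne']
  congr 1; ring

lemma cutoff : ∃ K : ℝ, 0 < K ∧ ∀ (S : Set ℝ), IsClosed S → ∀ δ : ℝ, 0 < δ →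
    ∃ η : ℝ → ℝ, ContDiff ℝ (⊤ : ℕ∞) η ∧ (∀ t, 0 ≤ η t ∧ η t ≤ 1) ∧
        (∀ t ∈ tNbhd S δ, η t = 1) ∧
        (∀ t ∉ tNbhd S (2 * δ), η t = 0) ∧ ∀ x y, |η x - η y| ≤ K / δ * |x - y| := by
  let b : ContDiffBump (0:ℝ) := ⟨1/4, 1/2, by norm_num, by norm_num⟩
  let φ : ℝ → ℝ := b.normed volume
  have hφs : ContDiff ℝ (⊤ : ℕ∞) φ := b.contDiff_normed
  have hφc : HasCompactSupport φ := b.hasCompactSupport_normed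
  have hφ0 : ∀ x, 0 ≤ φ x := b.nonneg_normed
  have hφi : Integrable φ := b.integrable_normed
  have hφ1 : ∫ x, φ x = 1 := b.integral_normed
  have hφsupp : ∀ x, φ x ≠ 0 → |x| < 1/2 := by
    intro x hx
    have : x ∈ Function.support φ := hx
    rw [b.support_normed_eq] at this
    simpa [b] using this
  have hφ1' : ContDiff ℝ 1 φ := hφs.of_le (by exact_mod_cast le_top)
  have hdi : Integrable (deriv φ) :=
    (hφ1'.continuous_deriv le_rfl).integrable_of_hasCompactSupport hφc.deriv
  refine ⟨(∫ x, |deriv φ x|) + 1, by positivity, ?_⟩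
  intro S hS δ hδ
  let B : Set ℝ := {u | δ * u ∈ tNbhd S (3 / 2 * δ)}
  have hB : MeasurableSet B := by
    have : Measurable fun u : ℝ => δ * u := by fun_prop
    exact this (tNbhd_closed hS (by positivity)).measurableSet
  let χ : ℝ → ℝ := B.indicator 1
  have hχ0 : ∀ u, 0 ≤ χ u := fun u => indicator_nonneg (fun _ _ => zero_le_one) u
  have hχ1 : ∀ u, χ u ≤ 1 := fun u => indicator_le_self' (fun _ _ => zero_le_one) u
  have hχm : Measurable χ := measurable_one.indicator hB
  have hχl : LocallyIntegrable χ := by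
    have := (locallyIntegrable_const (μ := (volume : Measure ℝ)) (1:ℝ)).indicator hB
    exact this
  let g : ℝ → ℝ := convolution φ χ (ContinuousLinearMap.mul ℝ ℝ) volume
  have hg : ∀ x, g x = ∫ t, φ t * χ (x - t) := fun x => rfl
  have hgs : ContDiff ℝ (⊤ : ℕ∞) g :=
    hφc.contDiff_convolution_left _ hφs hχl
  have hmi : ∀ ψ : ℝ → ℝ, Integrable ψ → ∀ x, Integrable fun t => ψ t * χ (x - t) := by
    intro ψ hψ x
    refine hψ.mul_bdd (c := 1) (hχm.comp (measurable_const.sub measurable_id)).aestronglyMeasurable (Filter.Eventually.of_forall fun t => ?_)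
    rw [Real.norm_of_nonneg (hχ0 _)]; exact hχ1 _
  have hgd : ∀ x, HasDerivAt g (∫ t, deriv φ t * χ (x - t)) x := fun x =>
    hφc.hasDerivAt_convolution_left _ hφ1' hχl x
  have hgL : ∀ x y, |g x - g y| ≤ ((∫ x, |deriv φ x|) + 1) * |x - y| := by
    intro x y
    refine Convex.norm_image_sub_le_of_norm_hasDerivWithin_le (s := univ)
      (fun z _ => (hgd z).hasDerivWithinAt) (fun z _ => ?_) convex_univ trivial trivial
    have : ‖∫ t, deriv φ t * χ (z - t)‖ ≤ ∫ t, |deriv φ t| := by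
      refine norm_integral_le_of_norm_le hdi.abs (Filter.Eventually.of_forall fun t => ?_)
      rw [norm_mul, Real.norm_of_nonneg (hχ0 _), Real.norm_eq_abs]
      exact mul_le_of_le_one_right (abs_nonneg _) (hχ1 _)
    linarith
  refine ⟨fun t => g (t / δ), by fun_prop, ?_, ?_, ?_, ?_⟩
  · intro t
    constructor
    · exact integral_nonneg fun u => mul_nonneg (hφ0 _) (hχ0 _)
    · simp only [hg]
      rw [← hφ1]
      exact integral_mono (hmi _ hφi _) hφi fun u => mul_le_of_le_one_right (hφ0 _) (hχ1 _)
  · rintro t ⟨s, hs, hts⟩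
    simp only [hg]
    rw [← hφ1]
    congr 1
    funext u
    by_cases hu : φ u = 0
    · simp [hu]
    · have h1 := hφsupp u hu
      have : t / δ - u ∈ B := by
        refine ⟨s, hs, ?_⟩
        have : δ * (t / δ - u) = t - δ * u := by field_simp
        rw [this]
        rw [abs_lt] at h1
        rw [abs_le] at hts ⊢
        constructor <;> nlinarith
      simp [χ, this]
  · intro t ht
    simp only [hg]
    rw [← integral_zero ℝ ℝ (μ := volume)]
    congr 1
    funext u
    by_cases hu : φ u = 0
    · simp [hu]
    · have h1 := hφsupp u hu
      have : t / δ - u ∉ B := by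
        rintro ⟨s, hs, hts⟩
        refine ht ⟨s, hs, ?_⟩
        have : δ * (t / δ - u) = t - δ * u := by field_simp
        rw [this] at hts
        rw [abs_lt] at h1
        rw [abs_le] at hts ⊢
        constructor <;> nlinarith
      simp [χ, this]
  · intro x y
    refine (hgL _ _).trans (le_of_eq ?_)
    rw [← sub_div, abs_div, abs_of_pos hδ]
    ring

lemma gagliardo_bound {A : Set ℝ} (hA : MeasurableSet A) {η : ℝ → ℝ} {K α q T : ℝ}
    (hq : 1 < q)
    (h01 : ∀ t, 0 ≤ η t ∧ η t ≤ 1) (h0 : ∀ t ∉ A, η t = 0)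
    (hL : ∀ x y, |η x - η y| ≤ K * |x - y|) :
    (∫⁻ z in (Icc (0:ℝ) T) ×ˢ (Icc (0:ℝ) T),
        ENNReal.ofReal (|η z.1 - η z.2| ^ q / |z.1 - z.2| ^ (1 + α * q)))
      ≤ 2 * (volume A * ∫⁻ u, ENNReal.ofReal (kerH K α q u)) := by
  let F : ℝ → ℝ≥0∞ := fun u => ENNReal.ofReal (kerH K α q u)
  have hF : Measurable F := (kerH_meas K α q).ennreal_ofReal
  let c : ℝ → ℝ≥0∞ := A.indicator 1
  have hc : Measurable c := measurable_one.indicator hA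
  have hm1 : Measurable fun z : ℝ × ℝ => c z.1 * F (z.1 - z.2) :=
    (hc.comp measurable_fst).mul (hF.comp (measurable_fst.sub measurable_snd))
  have hm2 : Measurable fun z : ℝ × ℝ => c z.2 * F (z.1 - z.2) :=
    (hc.comp measurable_snd).mul (hF.comp (measurable_fst.sub measurable_snd))
  have hcA : ∫⁻ x, c x = volume A := by
    simp only [c]; rw [lintegral_indicator_one hA]
  have e1 : ∫⁻ z : ℝ × ℝ, c z.1 * F (z.1 - z.2) = volume A * ∫⁻ u, F u := by
    rw [Measure.volume_eq_prod, lintegral_prod _ hm1.aemeasurable]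
    have : ∀ x, ∫⁻ y, c x * F (x - y) = c x * ∫⁻ u, F u := by
      intro x
      rw [lintegral_const_mul _ (show Measurable fun y => F (x - y) from hF.comp (measurable_const.sub measurable_id)),
        lintegral_sub_left_eq_self F x]
    simp_rw [this]
    rw [lintegral_mul_const _ hc, hcA]
  have e2 : ∫⁻ z : ℝ × ℝ, c z.2 * F (z.1 - z.2) = volume A * ∫⁻ u, F u := by
    rw [Measure.volume_eq_prod, lintegral_prod_symm _ hm2.aemeasurable]
    have : ∀ y, ∫⁻ x, c y * F (x - y) = c y * ∫⁻ u, F u := by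
      intro y
      rw [lintegral_const_mul _ (show Measurable fun x => F (x - y) from hF.comp (measurable_id.sub measurable_const)),
        lintegral_sub_right_eq_self F y]
    simp_rw [this]
    rw [lintegral_mul_const _ hc, hcA]
  calc _ ≤ ∫⁻ z : ℝ × ℝ, ENNReal.ofReal (|η z.1 - η z.2| ^ q / |z.1 - z.2| ^ (1 + α * q)) :=
        setLIntegral_le_lintegral _ _
    _ ≤ ∫⁻ z : ℝ × ℝ, (c z.1 * F (z.1 - z.2) + c z.2 * F (z.1 - z.2)) := by
        refine lintegral_mono fun z => ?_
        obtain ⟨x, y⟩ := z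
        simp only
        have hle : ENNReal.ofReal (|η x - η y| ^ q / |x - y| ^ (1 + α * q)) ≤ F (x - y) := by
          refine ENNReal.ofReal_le_ofReal ?_
          unfold kerH
          gcongr
          refine le_min ?_ (hL x y)
          rw [abs_le]
          constructor <;> linarith [(h01 x).1, (h01 x).2, (h01 y).1, (h01 y).2]
        by_cases hx : x ∈ A
        · refine hle.trans ?_
          simp [c, hx]
        · by_cases hy : y ∈ A
          · refine hle.trans ?_
            simp [c, hy]
          · rw [h0 x hx, h0 y hy]
            simp [Real.zero_rpow (by linarith : q ≠ 0)]
    _ = _ := by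
        rw [lintegral_add_left hm1, e1, e2, two_mul]

lemma lq_bound {A : Set ℝ} (hA : MeasurableSet A) {η : ℝ → ℝ} {q T : ℝ}
    (hq : 1 < q) (h01 : ∀ t, 0 ≤ η t ∧ η t ≤ 1) (h0 : ∀ t ∉ A, η t = 0) :
    (∫⁻ t in Icc (0:ℝ) T, ENNReal.ofReal (|η t| ^ q)) ≤ volume A := by
  rw [← lintegral_indicator_one hA]
  refine (setLIntegral_le_lintegral _ _).trans (lintegral_mono fun t => ?_)
  by_cases ht : t ∈ A
  · simp only [ht, indicator_of_mem, Pi.one_apply]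
    rw [← ENNReal.ofReal_one]
    refine ENNReal.ofReal_le_ofReal (Real.rpow_le_one (abs_nonneg _) ?_ (by linarith))
    rw [abs_of_nonneg (h01 t).1]; exact (h01 t).2
  · simp [h0 t ht, Real.zero_rpow (by linarith : q ≠ 0)]

/-- existence of smooth cutoffs adapted to a set of times of upper
Minkowski dimension at most `γ < 1`, with the fractional Sobolev bound
`‖η_δ‖_{W^{α,q}} ≤ C' δ^{(1−γ)/q − α}`. -/
theorem stmt8 (T γ C δ₀ : ℝ) (hT : 0 < T) (hγ0 : 0 ≤ γ) (hγ : γ < 1)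
    (hC : 0 < C) (hδ₀ : 0 < δ₀)
    (S : Set ℝ) (hS_closed : IsClosed S) (hS_sub : S ⊆ Ioo 0 T)
    (hdim : ∀ δ ∈ Ioo (0:ℝ) δ₀, volume (tNbhd S δ) ≤ ENNReal.ofReal (C * δ ^ (1 - γ))) :
    ∃ C' : ℝ → ℝ → ℝ, (∀ α q : ℝ, 0 < C' α q) ∧ ∃ δ₁ > 0, ∀ δ ∈ Ioo (0:ℝ) δ₁,
      ∃ η : ℝ → ℝ, ContDiff ℝ (⊤ : ℕ∞) η ∧ (∀ t, 0 ≤ η t ∧ η t ≤ 1) ∧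
        (∀ t ∈ tNbhd S δ, η t = 1) ∧
        (∀ t ∉ tNbhd S (2 * δ), η t = 0) ∧
        ∀ α ∈ Ioo (0:ℝ) 1, ∀ q : ℝ, 1 < q →
          WNorm T α q η ≤ ENNReal.ofReal (C' α q * δ ^ ((1 - γ) / q - α)) := by
  obtain ⟨K, hK, hcut⟩ := cutoff
  let m : ℝ := C * 2 ^ (1 - γ)
  have hm : 0 < m := by positivity
  let I : ℝ → ℝ → ℝ := fun α q => ∫ u, kerH K α q u
  have hI : ∀ α q, 0 ≤ I α q := fun α q => integral_nonneg fun u => kerH_nonneg hK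
  refine ⟨fun α q => m ^ (1 / q) + (2 * (m * I α q)) ^ (1 / q), ?_, min 1 (δ₀ / 2),
    by positivity, ?_⟩
  · intro α q
    have := hI α q
    positivity
  rintro δ ⟨hδ, hδ1⟩
  have hδ1' : δ < 1 := hδ1.trans_le (min_le_left _ _)
  have hδ2 : 2 * δ < δ₀ := by linarith [hδ1.trans_le (min_le_right 1 (δ₀ / 2))]
  obtain ⟨η, hs, h01, h1, h0, hL⟩ := hcut S hS_closed δ hδ
  refine ⟨η, hs, h01, h1, h0, ?_⟩
  intro α hα q hq
  have hq0 : 0 < q := by linarith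
  have hA : MeasurableSet (tNbhd S (2 * δ)) :=
    (tNbhd_closed hS_closed (by positivity)).measurableSet
  have hV : volume (tNbhd S (2 * δ)) ≤ ENNReal.ofReal (m * δ ^ (1 - γ)) := by
    refine (hdim (2 * δ) ⟨by positivity, hδ2⟩).trans (le_of_eq ?_)
    rw [Real.mul_rpow (by norm_num) hδ.le]
    simp only [m]
    ring_nf
  have hIn := hI α q
  have b1 := (lq_bound (T := T) hA hq h01 h0).trans hV
  have b2 := gagliardo_bound (α := α) (T := T) hA hq h01 h0 hL
  rw [kerH_scale hK hα hq hδ] at b2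
  have b3 : 2 * (volume (tNbhd S (2 * δ)) * ENNReal.ofReal (δ ^ (-(α * q)) * I α q))
      ≤ ENNReal.ofReal (2 * (m * I α q) * δ ^ (1 - γ - α * q)) := by
    refine (mul_le_mul_right (mul_le_mul_left hV _) _).trans (le_of_eq ?_)
    rw [← ENNReal.ofReal_mul (by positivity),
      show (2 : ℝ≥0∞) = ENNReal.ofReal 2 by simp, ← ENNReal.ofReal_mul (by norm_num)]
    congr 1
    rw [sub_eq_add_neg (1 - γ), Real.rpow_add hδ]
    ring
  have b4 := b2.trans b3
  have hqi : 0 ≤ 1 / q := by positivity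
  clear_value m
  unfold WNorm
  refine (add_le_add (ENNReal.rpow_le_rpow b1 hqi) (ENNReal.rpow_le_rpow b4 hqi)).trans ?_
  rw [ENNReal.ofReal_rpow_of_nonneg (by positivity) hqi,
    ENNReal.ofReal_rpow_of_nonneg (by positivity) hqi,
    ← ENNReal.ofReal_add (by positivity) (by positivity)]
  refine ENNReal.ofReal_le_ofReal ?_
  beta_reduce
  rw [Real.mul_rpow hm.le (by positivity), Real.mul_rpow (x := 2 * (m * I α q)) (by positivity) (by positivity),
    ← Real.rpow_mul hδ.le, ← Real.rpow_mul hδ.le, add_mul,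
    show (1 - γ - α * q) * (1 / q) = (1 - γ) / q - α by field_simp]
  have : δ ^ ((1 - γ) * (1 / q)) ≤ δ ^ ((1 - γ) / q - α) := by
    refine Real.rpow_le_rpow_of_exponent_ge hδ hδ1'.le ?_
    rw [mul_one_div]
    linarith [hα.1]
  gcongr
end
end

section
/- Let v ∈ L^p_t(B^θ_{p,∞}(𝕋^d)) with p ≥ 3, θ ∈ (0,1), let v_ε = v * ρ_ε and R_ε = v_ε ⊗ v_ε − (v⊗v)_ε. Then the approximate Duchon–Robert dissipation D^v_ε := R_ε : ∇v_ε satisfies ‖D^v_ε‖_{L^{p/3}_{x,t}} ≤ C ε^{3θ−1} ‖v‖³_{L^p_t(B^θ_{p,∞})}. In particular, if θ > 1/3 then D^v_ε → 0 in L^{p/3}_{x,t} as ε → 0. -/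
open MeasureTheory Set Filter
open scoped ENNReal Topology

noncomputable section

/-- Fundamental domain of the torus `𝕋^d = ℝ^d/ℤ^d`. -/
def Box (d : ℕ) : Set (EuclideanSpace ℝ (Fin d)) := {x | ∀ i, x i ∈ Ico (0:ℝ) 1}

/-- The rescaled mollification kernel `ρ_ε(y) = ε^{-d} ρ(y/ε)`. -/
def mollKer (d : ℕ) (ρ : EuclideanSpace ℝ (Fin d) → ℝ) (ε : ℝ)
    (y : EuclideanSpace ℝ (Fin d)) : ℝ :=
  ε ^ (-(d : ℝ)) * ρ (ε⁻¹ • y)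

/-- Spatial mollification of a time-dependent vector field. -/
def mollV (d : ℕ) (ρ : EuclideanSpace ℝ (Fin d) → ℝ) (ε : ℝ)
    (v : EuclideanSpace ℝ (Fin d) → ℝ → EuclideanSpace ℝ (Fin d))
    (x : EuclideanSpace ℝ (Fin d)) (t : ℝ) : EuclideanSpace ℝ (Fin d) :=
  ∫ y, mollKer d ρ ε y • v (x - y) t

/-- The Reynolds stress `R_ε = v_ε ⊗ v_ε − (v ⊗ v)_ε` (matrix entries). -/
def RmatT (d : ℕ) (ρ : EuclideanSpace ℝ (Fin d) → ℝ) (ε : ℝ)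
    (v : EuclideanSpace ℝ (Fin d) → ℝ → EuclideanSpace ℝ (Fin d))
    (x : EuclideanSpace ℝ (Fin d)) (t : ℝ) (i j : Fin d) : ℝ :=
  mollV d ρ ε v x t i * mollV d ρ ε v x t j
    - ∫ y, mollKer d ρ ε y * (v (x - y) t i * v (x - y) t j)

/-- The approximate Duchon–Robert dissipation `D^v_ε = R_ε : ∇v_ε`. -/
def DRapprox (d : ℕ) (ρ : EuclideanSpace ℝ (Fin d) → ℝ) (ε : ℝ)
    (v : EuclideanSpace ℝ (Fin d) → ℝ → EuclideanSpace ℝ (Fin d))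
    (x : EuclideanSpace ℝ (Fin d)) (t : ℝ) : ℝ :=
  ∑ i, ∑ j, RmatT d ρ ε v x t i j
    * fderiv ℝ (fun z => mollV d ρ ε v z t i) x (EuclideanSpace.single j 1)

lemma Box_eq (d : ℕ) : Box d =
    ZSpan.fundamentalDomain (EuclideanSpace.basisFun (Fin d) ℝ).toBasis := by
  ext x
  simp [Box, ZSpan.mem_fundamentalDomain]

lemma Box_meas (d : ℕ) : MeasurableSet (Box d) := by
  rw [Box_eq]; exact ZSpan.fundamentalDomain_measurableSet _

open scoped Pointwise in
lemma box_shift (d : ℕ) (F : EuclideanSpace ℝ (Fin d) → ℝ≥0∞)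
    (hF : ∀ (i : Fin d) x, F (x + EuclideanSpace.single i 1) = F x)
    (a : EuclideanSpace ℝ (Fin d)) :
    ∫⁻ x in Box d, F (x + a) = ∫⁻ x in Box d, F x := by
  have hper : ∀ g ∈ (Submodule.span ℤ
      (Set.range (EuclideanSpace.basisFun (Fin d) ℝ).toBasis)), ∀ x, F (g + x) = F x := by
    intro g hg
    induction hg using Submodule.span_induction with
    | mem y hy =>
      obtain ⟨i, rfl⟩ := hy
      intro x
      rw [add_comm]
      simpa using hF i x
    | zero => simp
    | add y z _ _ hy hz => intro x; rw [add_assoc, hy, hz]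
    | smul n y _ hy =>
      have hneg : ∀ x, F (-y + x) = F x := fun x => by
        rw [← hy (-y + x)]; simp
      intro x
      induction n using Int.induction_on generalizing x with
      | zero => simp
      | succ n ih => rw [add_smul, one_smul, add_assoc, ih, hy]
      | pred n ih => rw [sub_smul, one_smul, sub_eq_add_neg, add_assoc, ih, hneg]
  have h1 := ZSpan.isAddFundamentalDomain (EuclideanSpace.basisFun (Fin d) ℝ).toBasis
    (volume : Measure (EuclideanSpace ℝ (Fin d)))
  have : VAddInvariantMeasure (Submodule.span ℤ
      (Set.range (EuclideanSpace.basisFun (Fin d) ℝ).toBasis)) (EuclideanSpace ℝ (Fin d)) volume :=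
    ⟨fun c s _ => measure_preimage_add volume (c : EuclideanSpace ℝ (Fin d)) s⟩
  have h2 := h1.vadd_of_comm a
  have h3 := h1.setLIntegral_eq h2 F (fun g x => hper g.1 g.2 x)
  rw [← Box_eq] at h3
  rw [h3]
  have := (measurePreserving_add_right (volume : Measure (EuclideanSpace ℝ (Fin d)))
    a).setLIntegral_comp_preimage_emb (MeasurableEquiv.addRight a).measurableEmbedding F (a +ᵥ Box d)
  rw [← this]
  congr 2
  ext x
  simp [mem_vadd_set_iff_neg_vadd_mem, add_comm]

lemma meas_repl (d : ℕ) (f : EuclideanSpace ℝ (Fin d) → EuclideanSpace ℝ (Fin d))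
    (S : Set (EuclideanSpace ℝ (Fin d))) (hS : IsOpen S) :
    ∃ (fh : EuclideanSpace ℝ (Fin d) → EuclideanSpace ℝ (Fin d))
      (G : Set (EuclideanSpace ℝ (Fin d))), StronglyMeasurable fh ∧ IsClosed G ∧
      (∀ x ∈ G, ∀ᵐ y ∂(volume.restrict S), f (x - y) = fh (x - y)) ∧
      (∀ x ∉ G, ¬ AEStronglyMeasurable (fun y => f (x - y)) (volume.restrict S)) ∧
      (∀ y ∈ S, ∀ᵐ x ∂(volume.restrict G), f (x - y) = fh (x - y)) ∧
      (∀ᵐ x, ‖fh x‖ₑ ≤ ‖f x‖ₑ) := by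
  set G0 := {x | AEStronglyMeasurable (fun y => f (x - y)) (volume.restrict S)} with hG0
  set V : EuclideanSpace ℝ (Fin d) → Set (EuclideanSpace ℝ (Fin d)) :=
    fun x => (fun w => x - w) ⁻¹' S with hV
  have hVo : ∀ x, IsOpen (V x) := fun x => hS.preimage (by fun_prop)
  have hVm : ∀ x ∈ G0, AEStronglyMeasurable f (volume.restrict (V x)) := by
    intro x hx
    have hmp := (Measure.measurePreserving_sub_left
      (volume : Measure (EuclideanSpace ℝ (Fin d))) x).restrict_preimage hS.measurableSet
    have := AEStronglyMeasurable.comp_measurePreserving hx hmp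
    refine this.congr (ae_of_all _ fun w => ?_)
    simp
  obtain ⟨T, hTs, hTc, hTU⟩ := TopologicalSpace.isOpen_biUnion_countable G0 V (fun x _ => hVo x)
  set W := ⋃ x ∈ G0, V x with hW
  have hWo : IsOpen W := isOpen_biUnion fun x _ => hVo x
  have hWm : AEStronglyMeasurable f (volume.restrict W) := by
    rw [← hTU, biUnion_eq_iUnion]
    have := hTc.to_subtype
    rw [aestronglyMeasurable_iUnion_iff]
    exact fun i => hVm i (hTs i.2)
  have hae : ∀ᵐ x, x ∈ W → f x = hWm.mk f x :=
    (ae_restrict_iff' hWo.measurableSet).1 hWm.ae_eq_mk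
  have hae' : ∀ᵐ x, x ∈ W → f x = W.indicator (hWm.mk f) x := by
    filter_upwards [hae] with x hx hxW
    rw [indicator_of_mem hxW, hx hxW]
  refine ⟨W.indicator (hWm.mk f), {x | ∀ y ∈ S, x - y ∈ W}, 
    hWm.stronglyMeasurable_mk.indicator hWo.measurableSet, ?_, ?_, ?_, ?_, ?_⟩
  · have : {x | ∀ y ∈ S, x - y ∈ W} = (⋃ w ∈ Wᶜ, (fun x => x - w) ⁻¹' S)ᶜ := by
      ext x
      simp only [mem_ofPred_eq, mem_compl_iff, mem_iUnion, mem_preimage, not_exists]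
      constructor
      · intro h w hw hx
        exact hw (by simpa using h _ hx)
      · intro h y hy
        by_contra hc
        exact h _ hc (by simpa using hy)
    rw [this]
    exact (isOpen_biUnion fun w _ => hS.preimage (by fun_prop)).isClosed_compl
  · intro x hx
    rw [ae_restrict_iff' hS.measurableSet]
    filter_upwards [(Measure.measurePreserving_sub_left
      (volume : Measure (EuclideanSpace ℝ (Fin d))) x).quasiMeasurePreserving.ae hae'] with y hy hyS
    exact hy (hx y hyS)
  · intro x hx hc
    refine hx fun y hy => ?_
    exact mem_biUnion (show x ∈ G0 from hc) (by simpa [hV] using hy)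
  · intro y hyS
    have h1 := (measurePreserving_sub_right
      (volume : Measure (EuclideanSpace ℝ (Fin d))) y).quasiMeasurePreserving.ae hae'
    refine (ae_restrict_of_ae h1).mp ?_
    have hcl : IsClosed {x | ∀ y ∈ S, x - y ∈ W} := by
      have : {x | ∀ y ∈ S, x - y ∈ W} = (⋃ w ∈ Wᶜ, (fun x => x - w) ⁻¹' S)ᶜ := by
        ext x
        simp only [mem_ofPred_eq, mem_compl_iff, mem_iUnion, mem_preimage, not_exists]
        constructor
        · intro h w hw hx
          exact hw (by simpa using h _ hx)
        · intro h y hy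
          by_contra hc
          exact h _ hc (by simpa using hy)
      rw [this]
      exact (isOpen_biUnion fun w _ => hS.preimage (by fun_prop)).isClosed_compl
    filter_upwards [ae_restrict_mem hcl.measurableSet] with x hx h
    exact h (hx y hyS)
  · filter_upwards [hae'] with x hx
    by_cases h : x ∈ W
    · rw [hx h]
    · simp [indicator_of_notMem h]

lemma deriv_ae (d : ℕ) (h g : EuclideanSpace ℝ (Fin d) → ℝ) (G : Set (EuclideanSpace ℝ (Fin d)))
    (hG : IsClosed G) (hg : Differentiable ℝ g) (heq : ∀ x ∈ G, h x = g x) :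
    ∀ᵐ x, x ∈ G → ‖fderiv ℝ h x‖ ≤ ‖fderiv ℝ g x‖ := by
  rcases Nat.eq_zero_or_pos d with hd | hd
  · subst hd
    refine ae_of_all _ fun x _ => ?_
    have : fderiv ℝ h x = 0 := Subsingleton.elim _ _
    simp [this]
  set e : EuclideanSpace ℝ (Fin d) := EuclideanSpace.single ⟨0, hd⟩ 1 with he
  have hen : ‖e‖ = 1 := by simp [he]
  set s := G ∩ {x | DifferentiableAt ℝ h x} with hs
  have hsm : MeasurableSet s := hG.measurableSet.inter (measurableSet_of_differentiableAt ℝ h)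
  have hA : ApproximatesLinearOn (fun x => (h x - g x) • e)
      (0 : EuclideanSpace ℝ (Fin d) →L[ℝ] EuclideanSpace ℝ (Fin d)) s 0 := by
    intro x hx y hy
    simp [heq x hx.1, heq y hy.1]
  have := hA.norm_fderiv_sub_le volume hsm
    (fun x => (fderiv ℝ h x - fderiv ℝ g x).smulRight e)
    (fun x hx => ((hx.2.hasFDerivAt.sub (hg x).hasFDerivAt).smul_const e).hasFDerivWithinAt)
  rw [ae_restrict_iff' hsm] at this
  filter_upwards [this] with x hx hxG
  by_cases hd : DifferentiableAt ℝ h x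
  · have h1 := hx ⟨hxG, hd⟩
    have he0 : e ≠ 0 := by
      intro h0
      rw [h0] at hen
      simp at hen
    have h2 : fderiv ℝ h x - fderiv ℝ g x = 0 ∨ e = 0 := by simpa using h1
    have h3 := h2.resolve_right he0
    rw [sub_eq_zero.1 h3]
  · rw [fderiv_zero_of_not_differentiableAt hd]; simp

lemma jensen_aux {α F : Type*} [MeasurableSpace α] [NormedAddCommGroup F] (ν : Measure α)
    (m : ℝ≥0∞) (hm : ν univ = m) (hm0 : m ≠ 0) (hmt : m ≠ ∞) (u : α → F)
    (hu : AEStronglyMeasurable u ν) (r p : ℝ) (hr : 0 < r) (hrp : r ≤ p) :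
    ∫⁻ y, ‖u y‖ₑ ^ r ∂ν ≤ m * (m⁻¹ * ∫⁻ y, ‖u y‖ₑ ^ p ∂ν) ^ (r / p) := by
  have hP : IsProbabilityMeasure (m⁻¹ • ν) := ⟨by
    simp [hm, ENNReal.inv_mul_cancel hm0 hmt]⟩
  have h := eLpNorm'_le_eLpNorm'_of_exponent_le (μ := m⁻¹ • ν) hr hrp (f := u)
    (hu.mono_ac (Measure.smul_absolutelyContinuous))
  simp only [eLpNorm', lintegral_smul_measure, smul_eq_mul] at h
  have h2 := ENNReal.rpow_le_rpow h hr.le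
  rw [← ENNReal.rpow_mul, ← ENNReal.rpow_mul, one_div_mul_cancel hr.ne', ENNReal.rpow_one] at h2
  have h3 : 1 / p * r = r / p := by ring
  rw [h3] at h2
  calc ∫⁻ y, ‖u y‖ₑ ^ r ∂ν = m * (m⁻¹ * ∫⁻ y, ‖u y‖ₑ ^ r ∂ν) := by
        rw [← mul_assoc, ENNReal.mul_inv_cancel hm0 hmt, one_mul]
    _ ≤ _ := by gcongr

lemma enorm_int_le {d : ℕ} {F : Type*} [NormedAddCommGroup F] [NormedSpace ℝ F]
    (S : Set (EuclideanSpace ℝ (Fin d)))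
    (A : ℝ) (φ : EuclideanSpace ℝ (Fin d) → F) (w : EuclideanSpace ℝ (Fin d) → ℝ≥0∞)
    (hS : ∀ y ∉ S, φ y = 0) (hA : ∀ y, ‖φ y‖ₑ ≤ ENNReal.ofReal A * w y) :
    ‖∫ y, φ y‖ₑ ≤ ENNReal.ofReal A * ∫⁻ y in S, w y := by
  have h1 : ∫ y, φ y = ∫ y in S, φ y := by
    symm
    apply setIntegral_eq_integral_of_forall_compl_eq_zero
    exact fun y hy => hS y hy
  rw [h1]
  calc _ ≤ ∫⁻ y in S, ‖φ y‖ₑ := enorm_integral_le_lintegral_enorm _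
    _ ≤ ∫⁻ y in S, ENNReal.ofReal A * w y := lintegral_mono fun y => hA y
    _ = _ := lintegral_const_mul' _ _ ENNReal.ofReal_ne_top

lemma conv_deriv {d : ℕ} (k g : EuclideanSpace ℝ (Fin d) → ℝ) (hk : ContDiff ℝ 1 k)
    (hkc : HasCompactSupport k) (hk0 : ∀ y, 0 ≤ k y) (hg : LocallyIntegrable g volume)
    (B : ℝ) (hB : ∀ y, ‖fderiv ℝ k y‖ ≤ B) (c : ℝ) (x : EuclideanSpace ℝ (Fin d)) :
    DifferentiableAt ℝ (fun z => ∫ y, k y * g (z - y)) x ∧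
    ‖fderiv ℝ (fun z => ∫ y, k y * g (z - y)) x‖ₑ ≤
      ENNReal.ofReal B * ∫⁻ y in Function.support k, ‖g (x - y) - c‖ₑ := by
  have hgc : LocallyIntegrable (fun y => g y - c) volume :=
    hg.sub (locallyIntegrable_const c)
  have hki : Integrable k := hk.continuous.integrable_of_hasCompactSupport hkc
  have h := hkc.hasFDerivAt_convolution_left (ContinuousLinearMap.lsmul ℝ ℝ) hk hgc x
  have hce : ConvolutionExists k g (ContinuousLinearMap.lsmul ℝ ℝ) volume :=
    hkc.convolutionExists_left _ hk.continuous hg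
  have heq : (fun z => ∫ y, k y * g (z - y)) =
      fun z => convolution k (fun y => g y - c) (ContinuousLinearMap.lsmul ℝ ℝ) volume z
        + c * ∫ y, k y := by
    funext z
    have hi : Integrable (fun y => k y * g (z - y)) := by
      simpa [ConvolutionExistsAt] using hce z
    simp only [convolution, ContinuousLinearMap.lsmul_apply, smul_eq_mul, mul_sub]
    rw [integral_sub hi (hki.mul_const c), integral_mul_const]
    ring
  have h2 := h.add_const (c * ∫ y, k y)
  rw [heq]
  refine ⟨h2.differentiableAt, ?_⟩
  rw [HasFDerivAt.fderiv h2]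
  unfold convolution
  apply enorm_int_le
  · intro y hy
    have hy0 : k y = 0 := by simpa using hy
    have : fderiv ℝ k y = 0 := by
      apply IsLocalMin.fderiv_eq_zero
      exact Filter.Eventually.of_forall fun z => by simp [hy0, hk0 z]
    rw [this]; simp
  · intro y
    rw [← ofReal_norm, ← ofReal_norm, ← ENNReal.ofReal_mul ((norm_nonneg _).trans (hB y))]
    apply ENNReal.ofReal_le_ofReal
    have : ((ContinuousLinearMap.precompL (EuclideanSpace ℝ (Fin d))
      (ContinuousLinearMap.lsmul ℝ ℝ)) (fderiv ℝ k y)) (g (x - y) - c)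
        = (g (x - y) - c) • fderiv ℝ k y := by
      ext z
      simp [ContinuousLinearMap.precompL_apply, mul_comm]
      ring
    rw [this, norm_smul, mul_comm]
    gcongr
    exact hB y

lemma cov_bound {d : ℕ} (k : EuclideanSpace ℝ (Fin d) → ℝ) (hk : Continuous k)
    (hk0 : ∀ y, 0 ≤ k y) (A : ℝ) (hA : ∀ y, k y ≤ A) (hk1 : ∫ y, k y = 1)
    (hki : Integrable k)
    (u₁ u₂ : EuclideanSpace ℝ (Fin d) → ℝ) (c₁ c₂ : ℝ) (w : EuclideanSpace ℝ (Fin d) → ℝ≥0∞)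
    (h₁ : MemLp u₁ 2 (volume.restrict (Function.support k)))
    (h₂ : MemLp u₂ 2 (volume.restrict (Function.support k)))
    (hSfin : volume (Function.support k) ≠ ∞)
    (hw₁ : ∀ y, ‖u₁ y - c₁‖ₑ ≤ w y) (hw₂ : ∀ y, ‖u₂ y - c₂‖ₑ ≤ w y) :
    ‖(∫ y, k y * u₁ y) * (∫ y, k y * u₂ y) - ∫ y, k y * (u₁ y * u₂ y)‖ₑ ≤
      (ENNReal.ofReal A * ∫⁻ y in Function.support k, w y ^ (2:ℝ))
      + (ENNReal.ofReal A * ∫⁻ y in Function.support k, w y ^ (1:ℝ)) ^ 2 := by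
  have hfin : IsFiniteMeasure (volume.restrict (Function.support k)) :=
    ⟨by simpa using hSfin.lt_top⟩
  have hint : ∀ φ : EuclideanSpace ℝ (Fin d) → ℝ,
      Integrable φ (volume.restrict (Function.support k)) → Integrable fun y => k y * φ y := by
    intro φ hφ
    have h1 : IntegrableOn (fun y => k y * φ y) (Function.support k) := by
      refine Integrable.bdd_mul (c := A) hφ hk.aestronglyMeasurable (ae_of_all _ fun y => ?_)
      rw [Real.norm_of_nonneg (hk0 y)]; exact hA y
    refine (integrableOn_iff_integrable_of_support_subset ?_).1 h1
    intro y hy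
    simp only [Function.mem_support] at hy ⊢
    exact left_ne_zero_of_mul hy
  have i₁ := hint u₁ (h₁.integrable (by norm_num))
  have i₂ := hint u₂ (h₂.integrable (by norm_num))
  have i₁₂ := hint (fun y => u₁ y * u₂ y) (h₁.integrable_mul h₂)
  have e₁ : ∫ y, k y * (u₁ y - c₁) = (∫ y, k y * u₁ y) - c₁ := by
    simp only [mul_sub]
    rw [integral_sub i₁ (hki.mul_const _), integral_mul_const, hk1, one_mul]
  have e₂ : ∫ y, k y * (u₂ y - c₂) = (∫ y, k y * u₂ y) - c₂ := by
    simp only [mul_sub]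
    rw [integral_sub i₂ (hki.mul_const _), integral_mul_const, hk1, one_mul]
  have e₁₂ : ∫ y, k y * ((u₁ y - c₁) * (u₂ y - c₂)) = (∫ y, k y * (u₁ y * u₂ y))
      - c₂ * (∫ y, k y * u₁ y) - c₁ * (∫ y, k y * u₂ y) + c₁ * c₂ := by
    have : ∀ y, k y * ((u₁ y - c₁) * (u₂ y - c₂)) =
      k y * (u₁ y * u₂ y) - c₂ * (k y * u₁ y) - c₁ * (k y * u₂ y) + (c₁ * c₂) * k y := by
      intro y; ring
    simp only [this]
    have j₁ : Integrable (fun y => k y * (u₁ y * u₂ y) - c₂ * (k y * u₁ y)) :=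
      i₁₂.sub (i₁.const_mul _)
    have j₂ : Integrable (fun y => k y * (u₁ y * u₂ y) - c₂ * (k y * u₁ y)
      - c₁ * (k y * u₂ y)) := j₁.sub (i₂.const_mul _)
    rw [integral_add j₂ (hki.const_mul _), integral_sub j₁ (i₂.const_mul _),
      integral_sub i₁₂ (i₁.const_mul _)]
    simp only [integral_const_mul, hk1, mul_one]
  have key : (∫ y, k y * u₁ y) * (∫ y, k y * u₂ y) - ∫ y, k y * (u₁ y * u₂ y) =
      (∫ y, k y * (u₁ y - c₁)) * (∫ y, k y * (u₂ y - c₂))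
        - ∫ y, k y * ((u₁ y - c₁) * (u₂ y - c₂)) := by
    rw [e₁, e₂, e₁₂]; ring
  have hkA : ∀ y, ‖k y‖ₑ ≤ ENNReal.ofReal A := fun y => by
    rw [Real.enorm_of_nonneg (hk0 y)]; exact ENNReal.ofReal_le_ofReal (hA y)
  have hS0 : ∀ y ∉ Function.support k, k y = 0 := fun y hy => by simpa using hy
  have b₁ : ‖∫ y, k y * (u₁ y - c₁)‖ₑ ≤ ENNReal.ofReal A * ∫⁻ y in Function.support k, w y ^ (1:ℝ) := by
    apply enorm_int_le
    · intro y hy; simp [hS0 y hy]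
    · intro y
      rw [enorm_mul, ENNReal.rpow_one]
      exact mul_le_mul' (hkA y) (hw₁ y)
  have b₂ : ‖∫ y, k y * (u₂ y - c₂)‖ₑ ≤ ENNReal.ofReal A * ∫⁻ y in Function.support k, w y ^ (1:ℝ) := by
    apply enorm_int_le
    · intro y hy; simp [hS0 y hy]
    · intro y
      rw [enorm_mul, ENNReal.rpow_one]
      exact mul_le_mul' (hkA y) (hw₂ y)
  have b₁₂ : ‖∫ y, k y * ((u₁ y - c₁) * (u₂ y - c₂))‖ₑ ≤
      ENNReal.ofReal A * ∫⁻ y in Function.support k, w y ^ (2:ℝ) := by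
    apply enorm_int_le
    · intro y hy; simp [hS0 y hy]
    · intro y
      rw [enorm_mul, enorm_mul, ENNReal.rpow_two, sq]
      exact mul_le_mul' (hkA y) (mul_le_mul' (hw₁ y) (hw₂ y))
  rw [key]
  refine enorm_sub_le.trans ?_
  rw [add_comm, enorm_mul, sq]
  exact add_le_add b₁₂ (mul_le_mul' b₁ b₂)


lemma point_bound {d : ℕ} (k : EuclideanSpace ℝ (Fin d) → ℝ) (hk : ContDiff ℝ 1 k)
    (hkc : HasCompactSupport k) (hk0 : ∀ y, 0 ≤ k y) (A B : ℝ) (hA : ∀ y, k y ≤ A)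
    (hB : ∀ y, ‖fderiv ℝ k y‖ ≤ B) (hk1 : ∫ y, k y = 1)
    (m : ℝ≥0∞) (hm : volume (Function.support k) = m) (hm0 : m ≠ 0) (hmt : m ≠ ∞)
    (p : ℝ) (hp : 3 ≤ p)
    (f : EuclideanSpace ℝ (Fin d) → EuclideanSpace ℝ (Fin d))
    (hf : StronglyMeasurable f) (hfl : LocallyIntegrable f volume)
    (x c : EuclideanSpace ℝ (Fin d))
    (hx : MemLp (fun y => f (x - y)) 2 (volume.restrict (Function.support k)))
    (q : ℝ≥0∞) (hq : q = m⁻¹ * ∫⁻ y in Function.support k, ‖f (x - y) - c‖ₑ ^ p) (i j : Fin d) :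
    ‖(∫ y, k y * f (x - y) i) * (∫ y, k y * f (x - y) j)
        - ∫ y, k y * (f (x - y) i * f (x - y) j)‖ₑ *
      ‖fderiv ℝ (fun z => ∫ y, k y * f (z - y) i) x‖ₑ ≤
    ((ENNReal.ofReal A * m + (ENNReal.ofReal A * m) ^ 2) * (ENNReal.ofReal B * m)) * q ^ (3 / p) := by
  have hcoord : ∀ (z : EuclideanSpace ℝ (Fin d)) i, ‖z i‖ₑ ≤ ‖z‖ₑ := by
    intro z i
    rw [← ofReal_norm, ← ofReal_norm]
    exact ENNReal.ofReal_le_ofReal (PiLp.norm_apply_le z i)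
  have hmeas : AEStronglyMeasurable (fun y => f (x - y) - c)
      (volume.restrict (Function.support k)) :=
    ((hf.comp_measurable (by fun_prop)).sub stronglyMeasurable_const).aestronglyMeasurable
  have hmu : (volume.restrict (Function.support k)) univ = m := by simpa using hm
  have J1 := jensen_aux _ m hmu hm0 hmt _ hmeas 1 p (by norm_num) (by linarith)
  have J2 := jensen_aux _ m hmu hm0 hmt _ hmeas 2 p (by norm_num) (by linarith)
  rw [← hq] at J1 J2
  have hxi : ∀ i, MemLp (fun y => f (x - y) i) 2 (volume.restrict (Function.support k)) := by
    intro i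
    refine hx.of_le ?_ (ae_of_all _ fun y => PiLp.norm_apply_le _ i)
    have : Continuous fun z : EuclideanSpace ℝ (Fin d) => z i := by fun_prop
    exact this.comp_aestronglyMeasurable hx.1
  have hR := cov_bound k hk.continuous hk0 A hA hk1
    (hk.continuous.integrable_of_hasCompactSupport hkc)
    (fun y => f (x - y) i) (fun y => f (x - y) j) (c i) (c j) (fun y => ‖f (x - y) - c‖ₑ)
    (hxi i) (hxi j) (by rwa [hm]) (fun y => hcoord (f (x - y) - c) i)
    (fun y => hcoord (f (x - y) - c) j)
  have hfi : LocallyIntegrable (fun y => f y i) volume := by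
    intro z
    obtain ⟨U, hU, hi⟩ := hfl z
    exact ⟨U, hU, (EuclideanSpace.proj (𝕜 := ℝ) i).integrable_comp hi⟩
  have hD := (conv_deriv k (fun y => f y i) hk hkc hk0 hfi B hB (c i) x).2
  have hD' : ‖fderiv ℝ (fun z => ∫ y, k y * f (z - y) i) x‖ₑ ≤
      (ENNReal.ofReal B * m) * q ^ (1 / p) := by
    refine hD.trans ?_
    rw [mul_assoc]
    gcongr
    refine le_trans (lintegral_mono fun y => ?_) J1
    rw [ENNReal.rpow_one]
    exact hcoord (f (x - y) - c) i
  have hR' : ‖(∫ y, k y * f (x - y) i) * (∫ y, k y * f (x - y) j)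
        - ∫ y, k y * (f (x - y) i * f (x - y) j)‖ₑ ≤
      (ENNReal.ofReal A * m + (ENNReal.ofReal A * m) ^ 2) * q ^ (2 / p) := by
    refine hR.trans ?_
    have e : q ^ (2 / p) = (q ^ (1 / p)) ^ 2 := by
      rw [← ENNReal.rpow_two, ← ENNReal.rpow_mul]; congr 1; ring
    rw [add_mul]
    refine add_le_add ?_ ?_
    · rw [mul_assoc]; gcongr
    · rw [e, ← mul_pow, mul_assoc]; gcongr
  have e3 : q ^ (3 / p) = q ^ (2 / p) * q ^ (1 / p) := by
    rw [← ENNReal.rpow_add_of_nonneg]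
    · congr 1; ring
    · positivity
    · positivity
  calc _ ≤ ((ENNReal.ofReal A * m + (ENNReal.ofReal A * m) ^ 2) * q ^ (2 / p)) *
      ((ENNReal.ofReal B * m) * q ^ (1 / p)) := mul_le_mul' hR' hD'
    _ = _ := by rw [e3]; ring

lemma loc_fin {d : ℕ} (p : ℝ) (f fh : EuclideanSpace ℝ (Fin d) → EuclideanSpace ℝ (Fin d))
    (hper : ∀ (i : Fin d) x, f (x + EuclideanSpace.single i 1) = f x)
    (hfp : ∫⁻ x in Box d, ‖f x‖ₑ ^ p < ∞) (hp : 0 < p)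
    (hle : ∀ᵐ x, ‖fh x‖ₑ ≤ ‖f x‖ₑ) (K : Set (EuclideanSpace ℝ (Fin d))) (hK : IsCompact K) :
    ∫⁻ x in K, ‖fh x‖ₑ ^ p < ∞ := by
  refine hK.induction_on (p := fun K => ∫⁻ x in K, ‖fh x‖ₑ ^ p < ∞) (by simp) ?_ ?_ ?_
  · intro s t hst ht
    exact (lintegral_mono_set hst).trans_lt ht
  · intro s t hs ht
    exact (lintegral_union_le _ _ _).trans_lt (ENNReal.add_lt_top.2 ⟨hs, ht⟩)
  · intro x0 _
    refine ⟨Metric.ball x0 (1/2), mem_nhdsWithin_of_mem_nhds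
      (Metric.ball_mem_nhds _ (by norm_num)), ?_⟩
    set a : EuclideanSpace ℝ (Fin d) := -x0 + WithLp.toLp 2 (fun _ => (1/2 : ℝ)) with ha
    have hsub : Metric.ball x0 (1/2) ⊆ (fun x => x + a) ⁻¹' (Box d) := by
      intro x hx i
      have h1 : |x i - x0 i| < 1/2 := by
        refine lt_of_le_of_lt ?_ (mem_ball_iff_norm.1 hx)
        have := PiLp.norm_apply_le (x - x0) i
        simpa using this
      rw [abs_lt] at h1
      simp only [ha, PiLp.add_apply, PiLp.neg_apply]
      constructor <;> linarith [h1.1, h1.2]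
    calc ∫⁻ x in Metric.ball x0 (1/2), ‖fh x‖ₑ ^ p
        ≤ ∫⁻ x in Metric.ball x0 (1/2), ‖f x‖ₑ ^ p := by
          refine lintegral_mono_ae (ae_restrict_of_ae ?_)
          filter_upwards [hle] with x hx
          gcongr
      _ ≤ ∫⁻ x in (fun x => x + a) ⁻¹' (Box d), ‖f x‖ₑ ^ p := lintegral_mono_set hsub
      _ = ∫⁻ x in (fun x => x + a) ⁻¹' (Box d), ‖f ((x + a) + -a)‖ₑ ^ p := by simp
      _ = ∫⁻ x in Box d, ‖f (x + -a)‖ₑ ^ p :=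
          (measurePreserving_add_right (volume : Measure (EuclideanSpace ℝ (Fin d)))
            a).setLIntegral_comp_preimage_emb (MeasurableEquiv.addRight a).measurableEmbedding
              (fun x => ‖f (x + -a)‖ₑ ^ p) (Box d)
      _ = ∫⁻ x in Box d, ‖f x‖ₑ ^ p :=
          box_shift d (fun x => ‖f x‖ₑ ^ p) (fun i x => by simp only [hper]) (-a)
      _ < ∞ := hfp

lemma loc_memLp {d : ℕ} (p : ℝ) (f fh : EuclideanSpace ℝ (Fin d) → EuclideanSpace ℝ (Fin d))
    (hper : ∀ (i : Fin d) x, f (x + EuclideanSpace.single i 1) = f x)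
    (hfp : ∫⁻ x in Box d, ‖f x‖ₑ ^ p < ∞) (hp : 0 < p) (hm : StronglyMeasurable fh)
    (hle : ∀ᵐ x, ‖fh x‖ₑ ≤ ‖f x‖ₑ) (K : Set (EuclideanSpace ℝ (Fin d))) (hK : IsCompact K) :
    MemLp fh (ENNReal.ofReal p) (volume.restrict K) := by
  refine ⟨hm.aestronglyMeasurable, ?_⟩
  rw [eLpNorm_lt_top_iff_lintegral_rpow_enorm_lt_top (by simpa using hp) (by simp)]
  rw [ENNReal.toReal_ofReal hp.le]
  exact loc_fin p f fh hper hfp hp hle K hK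

set_option maxHeartbeats 1000000 in
lemma slice_bound {d : ℕ} (k : EuclideanSpace ℝ (Fin d) → ℝ) (hk : ContDiff ℝ 1 k)
    (hkc : HasCompactSupport k) (hk0 : ∀ y, 0 ≤ k y) (A B : ℝ) (hA : ∀ y, k y ≤ A)
    (hB : ∀ y, ‖fderiv ℝ k y‖ ≤ B) (hk1 : ∫ y, k y = 1)
    (m : ℝ≥0∞) (hm : volume (Function.support k) = m) (hm0 : m ≠ 0) (hmt : m ≠ ∞)
    (p : ℝ) (hp : 3 ≤ p)
    (f : EuclideanSpace ℝ (Fin d) → EuclideanSpace ℝ (Fin d))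
    (hper : ∀ (i : Fin d) x, f (x + EuclideanSpace.single i 1) = f x)
    (hfp : ∫⁻ x in Box d, ‖f x‖ₑ ^ p < ∞) (M : ℝ≥0∞)
    (hM : ∀ y ∈ Function.support k, ∀ y' ∈ Function.support k,
      ∫⁻ x in Box d, ‖f (x - y) - f (x - y')‖ₑ ^ p ≤ M) :
    ∫⁻ x in Box d, ‖∑ i, ∑ j, ((∫ y, k y • f (x - y)) i * (∫ y, k y • f (x - y)) j
        - ∫ y, k y * (f (x - y) i * f (x - y) j)) *
      fderiv ℝ (fun z => (∫ y, k y • f (z - y)) i) x (EuclideanSpace.single j 1)‖ₑ ^ (p / 3) ≤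
    ((d : ℝ≥0∞) * (d * ((ENNReal.ofReal A * m + (ENNReal.ofReal A * m) ^ 2) *
      (ENNReal.ofReal B * m)))) ^ (p / 3) * M := by
  have hp0 : 0 < p := by linarith
  set S := Function.support k with hSdef
  have hSo : IsOpen S := hk.continuous.isOpen_support
  set L : ℝ≥0∞ := (ENNReal.ofReal A * m + (ENNReal.ofReal A * m) ^ 2) * (ENNReal.ofReal B * m)
    with hL
  obtain ⟨fh, G, hfh, hG, h1, h2, h3, h4⟩ := meas_repl d f S hSo
  have hmem := loc_memLp p f fh hper hfp hp0 hfh h4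
  have hfl : LocallyIntegrable fh volume := by
    rw [locallyIntegrable_iff]
    intro K hK
    have : IsFiniteMeasure (volume.restrict K) := ⟨by simpa using hK.measure_lt_top⟩
    refine (hmem K hK).integrable ?_
    rw [← ENNReal.ofReal_one]; exact ENNReal.ofReal_le_ofReal (by linarith)
  have hmemS : ∀ x, MemLp (fun y => fh (x - y)) 2 (volume.restrict S) := by
    intro x
    have hc : IsCompact ((fun y => x - y) '' tsupport k) := hkc.isCompact.image (by fun_prop)
    have hfin : IsFiniteMeasure (volume.restrict ((fun y => x - y) '' tsupport k)) :=
      ⟨by simpa using hc.measure_lt_top⟩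
    have hK2 : MemLp fh 2 (volume.restrict ((fun y => x - y) '' tsupport k)) := by
      refine (hmem _ hc).mono_exponent ?_
      rw [show (2 : ℝ≥0∞) = ENNReal.ofReal 2 by simp]
      exact ENNReal.ofReal_le_ofReal (by linarith)
    have hmp := (Measure.measurePreserving_sub_left
      (volume : Measure (EuclideanSpace ℝ (Fin d))) x).restrict_preimage hc.measurableSet
    refine (hK2.comp_measurePreserving hmp).mono_measure (Measure.restrict_mono ?_ le_rfl)
    intro y hy
    exact ⟨y, subset_tsupport k hy, rfl⟩
  have hkne : ∀ y ∉ S, k y = 0 := fun y hy => by simpa [hSdef] using hy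
  -- integrals on G
  have hae : ∀ x ∈ G, ∀ᵐ y, k y ≠ 0 → f (x - y) = fh (x - y) := fun x hx =>
    (ae_restrict_iff' hSo.measurableSet).1 (h1 x hx)
  have hintk : ∀ x, Integrable (fun y => k y • fh (x - y)) := fun x => by
    simpa [ConvolutionExistsAt] using hkc.convolutionExists_left
      (ContinuousLinearMap.lsmul ℝ ℝ) hk.continuous hfl x
  have hV : ∀ x ∈ G, ∀ i, (∫ y, k y • f (x - y)) i = ∫ y, k y * fh (x - y) i := by
    intro x hx i
    have e1 : ∫ y, k y • f (x - y) = ∫ y, k y • fh (x - y) := by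
      refine integral_congr_ae ?_
      filter_upwards [hae x hx] with y hy
      by_cases h : k y = 0
      · simp [h]
      · rw [hy h]
    rw [e1]
    have := (EuclideanSpace.proj (𝕜 := ℝ) i).integral_comp_comm (hintk x)
    simpa using this.symm
  have hVV : ∀ x ∈ G, ∀ i j, ∫ y, k y * (f (x - y) i * f (x - y) j) =
      ∫ y, k y * (fh (x - y) i * fh (x - y) j) := by
    intro x hx i j
    refine integral_congr_ae ?_
    filter_upwards [hae x hx] with y hy
    by_cases h : k y = 0
    · simp [h]
    · simp only [hy h]
  have hout : ∀ x ∉ G, ∫ y, k y • f (x - y) = 0 := by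
    intro x hx
    apply integral_undef
    intro hi
    apply h2 x hx
    have : AEStronglyMeasurable (fun y => (k y)⁻¹ • (k y • f (x - y))) (volume.restrict S) := by
      have hinv : AEStronglyMeasurable (fun y => (k y)⁻¹) (volume.restrict S) :=
        (hk.continuous.measurable.inv).aestronglyMeasurable
      exact hinv.smul hi.1.restrict
    refine this.congr ?_
    filter_upwards [ae_restrict_mem hSo.measurableSet] with y hy
    rw [smul_smul, inv_mul_cancel₀ hy, one_smul]
  have hfi : ∀ i, LocallyIntegrable (fun y => fh y i) volume := by
    intro i z
    obtain ⟨U, hU, hi⟩ := hfl z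
    exact ⟨U, hU, (EuclideanSpace.proj (𝕜 := ℝ) i).integrable_comp hi⟩
  have hder : ∀ᵐ x, ∀ i, x ∈ G → ‖fderiv ℝ (fun z => (∫ y, k y • f (z - y)) i) x‖ ≤
      ‖fderiv ℝ (fun z => ∫ y, k y * fh (z - y) i) x‖ := by
    rw [ae_all_iff]
    intro i
    exact deriv_ae d _ _ G hG
      (fun x => (conv_deriv k (fun y => fh y i) hk hkc hk0 (hfi i) B hB 0 x).1)
      (fun x hx => hV x hx i)
  set Dx : EuclideanSpace ℝ (Fin d) → ℝ := fun x =>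
    ∑ i, ∑ j, ((∫ y, k y • f (x - y)) i * (∫ y, k y • f (x - y)) j
        - ∫ y, k y * (f (x - y) i * f (x - y) j)) *
      fderiv ℝ (fun z => (∫ y, k y • f (z - y)) i) x (EuclideanSpace.single j 1) with hDx
  have hD0 : ∀ x ∉ G, Dx x = 0 := by
    intro x hx
    refine Finset.sum_eq_zero fun i _ => Finset.sum_eq_zero fun j _ => ?_
    have : fderiv ℝ (fun z => (∫ y, k y • f (z - y)) i) x = 0 := by
      have he : (fun z => (∫ y, k y • f (z - y)) i) =ᶠ[𝓝 x] fun _ => (0:ℝ) := by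
        filter_upwards [hG.isOpen_compl.mem_nhds hx] with z hz
        rw [hout z hz]; simp
      rw [he.fderiv_eq]; simp
    rw [this]; simp
  have hpt : ∀ᵐ x, x ∈ G → ∀ c, ‖Dx x‖ₑ ^ (p / 3) ≤ ((d : ℝ≥0∞) * (d * L)) ^ (p / 3) *
      (m⁻¹ * ∫⁻ y in S, ‖fh (x - y) - c‖ₑ ^ p) := by
    filter_upwards [hder] with x hx hxG c
    set q := m⁻¹ * ∫⁻ y in S, ‖fh (x - y) - c‖ₑ ^ p with hq
    have hb : ‖Dx x‖ₑ ≤ (d : ℝ≥0∞) * (d * L) * q ^ (3 / p) := by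
      calc ‖Dx x‖ₑ ≤ ∑ i : Fin d, ∑ j : Fin d, L * q ^ (3 / p) := by
            refine (enorm_sum_le _ _).trans (Finset.sum_le_sum fun i _ => ?_)
            refine (enorm_sum_le _ _).trans (Finset.sum_le_sum fun j _ => ?_)
            refine le_trans ?_ (point_bound k hk hkc hk0 A B hA hB hk1 m hm hm0 hmt p hp fh hfh hfl
              x c (hmemS x) q hq i j)
            rw [enorm_mul, hV x hxG i, hV x hxG j, hVV x hxG i j]
            gcongr
            rw [← ofReal_norm, ← ofReal_norm]
            apply ENNReal.ofReal_le_ofReal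
            refine le_trans ?_ (hx i hxG)
            refine (ContinuousLinearMap.le_opNorm _ _).trans ?_
            simp
        _ = _ := by simp; ring
    calc _ ≤ ((d : ℝ≥0∞) * (d * L) * q ^ (3 / p)) ^ (p / 3) := by gcongr
      _ = _ := by
        rw [ENNReal.mul_rpow_of_nonneg _ _ (by positivity), ← ENNReal.rpow_mul]
        have : 3 / p * (p / 3) = 1 := by field_simp
        rw [this, ENNReal.rpow_one]
  set Λ := ((d : ℝ≥0∞) * (d * L)) ^ (p / 3) with hΛ
  set σ := (volume.restrict S).prod (volume.restrict S) with hσ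
  set Φ : EuclideanSpace ℝ (Fin d) → EuclideanSpace ℝ (Fin d) × EuclideanSpace ℝ (Fin d) → ℝ≥0∞ :=
    fun x z => ‖fh (x - z.2) - fh (x - z.1)‖ₑ ^ p with hΦ
  have hΦm : Measurable (Function.uncurry Φ) := by
    have hfm := hfh.measurable
    simp only [hΦ]
    unfold Function.uncurry
    fun_prop
  have hpt2 : ∀ᵐ x, x ∈ G → ‖Dx x‖ₑ ^ (p / 3) ≤ Λ * (m⁻¹ * m⁻¹) * ∫⁻ z, Φ x z ∂σ := by
    filter_upwards [hpt] with x hx hxG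
    have hmeasx : Measurable (Φ x) := hΦm.of_uncurry_left
    have hmi : m⁻¹ ≠ ∞ := ENNReal.inv_ne_top.2 hm0
    have hmeas2 : Measurable fun y' => ∫⁻ y in S, Φ x (y', y) := hmeasx.lintegral_prod_right'
    calc ‖Dx x‖ₑ ^ (p / 3) = m⁻¹ * ∫⁻ y' in S, ‖Dx x‖ₑ ^ (p / 3) := by
          rw [lintegral_const, Measure.restrict_apply_univ, hm, mul_comm, mul_assoc,
            ENNReal.mul_inv_cancel hm0 hmt, mul_one]
      _ ≤ m⁻¹ * ∫⁻ y' in S, Λ * (m⁻¹ * ∫⁻ y in S, Φ x (y', y)) := by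
          gcongr with y'
          exact hx hxG (fh (x - y'))
      _ = Λ * (m⁻¹ * m⁻¹) * ∫⁻ z, Φ x z ∂σ := by
          rw [lintegral_const_mul _ (hmeas2.const_mul _), lintegral_const_mul _ hmeas2, hσ,
            lintegral_prod _ hmeasx.aemeasurable]
          ring
  have hcompl : ∀ᵐ x, ‖Dx x‖ₑ ^ (p / 3) ≤
      G.indicator (fun x => Λ * (m⁻¹ * m⁻¹) * ∫⁻ z, Φ x z ∂σ) x := by
    filter_upwards [hpt2] with x hx
    by_cases hxG : x ∈ G
    · rw [indicator_of_mem hxG]; exact hx hxG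
    · rw [hD0 x hxG, indicator_of_notMem hxG]
      simp; linarith
  have hΦz : ∀ z ∈ S ×ˢ S, ∫⁻ x in G, Φ x z ∂(volume.restrict (Box d)) ≤ M := by
    intro z hz
    calc _ ≤ ∫⁻ x in G, ‖f (x - z.2) - f (x - z.1)‖ₑ ^ p ∂(volume.restrict (Box d)) := by
          refine lintegral_mono_ae ?_
          have hac : (volume.restrict (Box d)).restrict G ≪ volume.restrict G :=
            (Measure.restrict_mono subset_rfl Measure.restrict_le_self).absolutelyContinuous
          filter_upwards [hac.ae_le (h3 z.1 hz.1), hac.ae_le (h3 z.2 hz.2)] with x hx1 hx2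
          simp only [hΦ, hx1, hx2, le_refl]
      _ ≤ ∫⁻ x in Box d, ‖f (x - z.2) - f (x - z.1)‖ₑ ^ p := setLIntegral_le_lintegral _ _
      _ ≤ M := hM z.2 hz.2 z.1 hz.1
  have hΦi : Measurable fun x => ∫⁻ z, Φ x z ∂σ := hΦm.lintegral_prod_right
  calc ∫⁻ x in Box d, ‖Dx x‖ₑ ^ (p / 3)
      ≤ ∫⁻ x in Box d, G.indicator (fun x => Λ * (m⁻¹ * m⁻¹) * ∫⁻ z, Φ x z ∂σ) x :=
        lintegral_mono_ae (ae_restrict_of_ae hcompl)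
    _ = ∫⁻ x in G, Λ * (m⁻¹ * m⁻¹) * ∫⁻ z, Φ x z ∂σ ∂(volume.restrict (Box d)) :=
        lintegral_indicator hG.measurableSet _
    _ = Λ * (m⁻¹ * m⁻¹) * ∫⁻ x in G, ∫⁻ z, Φ x z ∂σ ∂(volume.restrict (Box d)) :=
        lintegral_const_mul _ hΦi
    _ = Λ * (m⁻¹ * m⁻¹) * ∫⁻ z, ∫⁻ x in G, Φ x z ∂(volume.restrict (Box d)) ∂σ := by
        rw [lintegral_lintegral_swap hΦm.aemeasurable]
    _ ≤ Λ * (m⁻¹ * m⁻¹) * ∫⁻ z, M ∂σ := by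
        refine mul_le_mul' le_rfl (lintegral_mono_ae ?_)
        rw [hσ, Measure.prod_restrict]
        filter_upwards [ae_restrict_mem (hSo.measurableSet.prod hSo.measurableSet)] with z hz
        exact hΦz z hz
    _ = Λ * M := by
        rw [lintegral_const, hσ, Measure.prod_restrict, Measure.restrict_apply_univ,
          Measure.prod_prod, hm]
        have : m⁻¹ * m = 1 := ENNReal.inv_mul_cancel hm0 hmt
        calc Λ * (m⁻¹ * m⁻¹) * (M * (m * m)) = Λ * M * (m⁻¹ * m) * (m⁻¹ * m) := by ring
          _ = _ := by rw [this]; simp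

lemma ker_facts (d : ℕ) (ρ : EuclideanSpace ℝ (Fin d) → ℝ)
    (hρ_smooth : ContDiff ℝ (⊤ : ℕ∞) ρ) (hρ_nonneg : ∀ y, 0 ≤ ρ y)
    (hρ_supp : Function.support ρ ⊆ Metric.ball 0 1) (hρ_int : ∫ y, ρ y = 1) :
    ∃ A B μ : ℝ, 0 ≤ A ∧ 0 ≤ B ∧ 0 < μ ∧ ∀ ε : ℝ, 0 < ε →
      ContDiff ℝ 1 (mollKer d ρ ε) ∧ HasCompactSupport (mollKer d ρ ε) ∧
      (∀ y, 0 ≤ mollKer d ρ ε y) ∧ (∀ y, mollKer d ρ ε y ≤ ε ^ (-(d:ℝ)) * A) ∧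
      (∀ y, ‖fderiv ℝ (mollKer d ρ ε) y‖ ≤ ε ^ (-(d:ℝ)) * (B / ε)) ∧
      (∫ y, mollKer d ρ ε y = 1) ∧
      (volume (Function.support (mollKer d ρ ε)) = ENNReal.ofReal (ε ^ (d:ℝ) * μ)) ∧
      (∀ y ∈ Function.support (mollKer d ρ ε), ‖y‖ ≤ ε) := by
  have hsm : ContDiff ℝ 1 ρ := hρ_smooth.of_le (by exact_mod_cast le_top)
  have hcs : HasCompactSupport ρ := HasCompactSupport.of_support_subset_isCompact
    (isCompact_closedBall 0 1) (hρ_supp.trans Metric.ball_subset_closedBall)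
  obtain ⟨A, hA⟩ := hsm.continuous.bounded_above_of_compact_support hcs
  obtain ⟨B, hB⟩ := (hsm.continuous_fderiv one_ne_zero).bounded_above_of_compact_support
    (hcs.fderiv ℝ)
  have hmt : volume (Function.support ρ) ≠ ∞ :=
    ((measure_mono hρ_supp).trans_lt measure_ball_lt_top).ne
  have hm0 : volume (Function.support ρ) ≠ 0 := by
    intro h0
    have : ρ =ᵐ[volume] 0 := by
      rw [Filter.EventuallyEq, ae_iff]
      exact h0
    rw [integral_congr_ae this] at hρ_int
    simp at hρ_int
  refine ⟨A, B, (volume (Function.support ρ)).toReal, (norm_nonneg _).trans (hA 0),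
    (norm_nonneg _).trans (hB 0), ENNReal.toReal_pos hm0 hmt, ?_⟩
  intro ε hε
  have hεd : 0 < ε ^ (-(d:ℝ)) := Real.rpow_pos_of_pos hε _
  have hsupp : Function.support (mollKer d ρ ε) = (fun y => ε⁻¹ • y) ⁻¹' Function.support ρ := by
    ext y
    simp [mollKer, hε.ne']
  have hnorm : ∀ y ∈ Function.support (mollKer d ρ ε), ‖y‖ ≤ ε := by
    intro y hy
    rw [hsupp] at hy
    have := hρ_supp hy
    rw [mem_ball_zero_iff, norm_smul, norm_inv, Real.norm_of_nonneg hε.le] at this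
    have h2 : ‖y‖ = ε * (ε⁻¹ * ‖y‖) := by field_simp
    rw [h2]; nlinarith
  have hder : ∀ y, HasFDerivAt (mollKer d ρ ε)
      (ε ^ (-(d:ℝ)) • ((fderiv ℝ ρ (ε⁻¹ • y)).comp
        (ε⁻¹ • ContinuousLinearMap.id ℝ (EuclideanSpace ℝ (Fin d))))) y := by
    intro y
    have h1 : HasFDerivAt (fun y : EuclideanSpace ℝ (Fin d) => ε⁻¹ • y)
      (ε⁻¹ • ContinuousLinearMap.id ℝ (EuclideanSpace ℝ (Fin d))) y :=
      (ε⁻¹ • ContinuousLinearMap.id ℝ (EuclideanSpace ℝ (Fin d))).hasFDerivAt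
    have h2 := ((hsm.differentiable one_ne_zero) (ε⁻¹ • y)).hasFDerivAt
    exact (h2.comp y h1).const_mul _
  refine ⟨?_, ?_, ?_, ?_, ?_, ?_, ?_, hnorm⟩
  · unfold mollKer
    exact contDiff_const.mul (hsm.comp (contDiff_const_smul _))
  · exact HasCompactSupport.of_support_subset_isCompact (isCompact_closedBall 0 ε)
      (fun y hy => by simpa using hnorm y hy)
  · exact fun y => mul_nonneg hεd.le (hρ_nonneg _)
  · intro y
    unfold mollKer
    gcongr
    exact (Real.le_norm_self _).trans (hA _)
  · intro y
    rw [(hder y).fderiv, norm_smul, Real.norm_of_nonneg hεd.le]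
    gcongr
    refine (ContinuousLinearMap.opNorm_comp_le _ _).trans ?_
    rw [norm_smul, norm_inv, Real.norm_of_nonneg hε.le, div_eq_mul_inv]
    have h1 := ContinuousLinearMap.norm_id_le (𝕜 := ℝ) (E := EuclideanSpace ℝ (Fin d))
    have hi : 0 < ε⁻¹ := inv_pos.2 hε
    refine mul_le_mul (hB _) ?_ (by positivity) ((norm_nonneg _).trans (hB 0))
    nlinarith
  · unfold mollKer
    rw [integral_const_mul, Measure.integral_comp_inv_smul, hρ_int]
    simp only [finrank_euclideanSpace, Fintype.card_fin, smul_eq_mul, mul_one]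
    rw [abs_of_pos (by positivity), ← Real.rpow_natCast, ← Real.rpow_add hε]
    simp
  · rw [hsupp]
    have := Measure.addHaar_preimage_smul (volume : Measure (EuclideanSpace ℝ (Fin d)))
      (inv_ne_zero hε.ne') (Function.support ρ)
    rw [this, ENNReal.ofReal_mul (by positivity), ENNReal.ofReal_toReal hmt]
    congr 2
    simp only [finrank_euclideanSpace, Fintype.card_fin]
    rw [inv_pow, inv_inv, abs_of_pos (by positivity), Real.rpow_natCast]

lemma slice_final (d : ℕ) (ρ : EuclideanSpace ℝ (Fin d) → ℝ)
    (hρ_smooth : ContDiff ℝ (⊤ : ℕ∞) ρ) (hρ_nonneg : ∀ y, 0 ≤ ρ y)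
    (hρ_supp : Function.support ρ ⊆ Metric.ball 0 1) (hρ_int : ∫ y, ρ y = 1)
    (p θ : ℝ) (hp : 3 ≤ p) (hθ : 0 < θ) :
    ∃ κ : ℝ, 0 ≤ κ ∧ ∀ (v : EuclideanSpace ℝ (Fin d) → ℝ → EuclideanSpace ℝ (Fin d))
      (t β : ℝ),
      (∀ (i : Fin d) (x : EuclideanSpace ℝ (Fin d)),
        v (x + EuclideanSpace.single i 1) t = v x t) →
      (eLpNorm (fun x => v x t) (ENNReal.ofReal p) (volume.restrict (Box d))
          ≤ ENNReal.ofReal β) →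
      (∀ h : EuclideanSpace ℝ (Fin d), h ≠ 0 →
        eLpNorm (fun x => v (x + h) t - v x t) (ENNReal.ofReal p) (volume.restrict (Box d))
          ≤ ENNReal.ofReal (‖h‖ ^ θ * β)) → ∀ ε : ℝ, 0 < ε →
      ∫⁻ x in Box d, ‖DRapprox d ρ ε v x t‖ₑ ^ (p / 3) ≤
        ENNReal.ofReal (κ / ε) ^ (p / 3) * ENNReal.ofReal ((2 * ε) ^ θ) ^ p
          * ENNReal.ofReal β ^ p := by
  obtain ⟨A, B, μ, hA, hB, hμ, H⟩ := ker_facts d ρ hρ_smooth hρ_nonneg hρ_supp hρ_int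
  have hp0 : 0 < p := by linarith
  have hconv : ∀ (g : EuclideanSpace ℝ (Fin d) → EuclideanSpace ℝ (Fin d)) (c : ℝ≥0∞),
      eLpNorm g (ENNReal.ofReal p) (volume.restrict (Box d)) ≤ c →
      ∫⁻ x in Box d, ‖g x‖ₑ ^ p ≤ c ^ p := by
    intro g c h
    rw [eLpNorm_eq_lintegral_rpow_enorm_toReal (by simpa using hp0) (by simp),
      ENNReal.toReal_ofReal hp0.le] at h
    have := ENNReal.rpow_le_rpow h hp0.le
    rwa [← ENNReal.rpow_mul, one_div_mul_cancel hp0.ne', ENNReal.rpow_one] at this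
  refine ⟨d * (d * ((A * μ + (A * μ) ^ 2) * (B * μ))), by positivity, ?_⟩
  intro v t β hper hb hdiff ε hε
  obtain ⟨K1, K2, K3, K4, K5, K6, K7, K8⟩ := H ε hε
  have hεd : 0 < ε ^ (d:ℝ) := Real.rpow_pos_of_pos hε _
  have hεd' : 0 < ε ^ (-(d:ℝ)) := Real.rpow_pos_of_pos hε _
  have hcan : ε ^ (-(d:ℝ)) * ε ^ (d:ℝ) = 1 := by rw [← Real.rpow_add hε]; simp
  have hfin : ∫⁻ x in Box d, ‖v x t‖ₑ ^ p < ∞ :=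
    (hconv _ _ hb).trans_lt (ENNReal.rpow_lt_top_of_nonneg hp0.le ENNReal.ofReal_ne_top)
  have key := slice_bound (mollKer d ρ ε) K1 K2 K3 _ _ K4 K5 K6 _ K7
    (by simp; positivity) ENNReal.ofReal_ne_top p hp (fun x => v x t) hper hfin
    ((ENNReal.ofReal ((2 * ε) ^ θ) * ENNReal.ofReal β) ^ p) ?_
  · refine key.trans (le_of_eq ?_)
    rw [ENNReal.mul_rpow_of_nonneg _ _ hp0.le, ← mul_assoc]
    congr 3
    rw [← ENNReal.ofReal_mul (by positivity), ← ENNReal.ofReal_mul (by positivity),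
      ← ENNReal.ofReal_pow (by positivity), ← ENNReal.ofReal_add (by positivity) (by positivity),
      ← ENNReal.ofReal_mul (by positivity), ← ENNReal.ofReal_natCast,
      ← ENNReal.ofReal_mul (by positivity), ← ENNReal.ofReal_mul (by positivity)]
    congr 1
    have e1 : ε ^ (-(d:ℝ)) * A * (ε ^ (d:ℝ) * μ) = A * μ := by
      calc _ = (ε ^ (-(d:ℝ)) * ε ^ (d:ℝ)) * (A * μ) := by ring
        _ = _ := by rw [hcan, one_mul]
    have e2 : ε ^ (-(d:ℝ)) * (B / ε) * (ε ^ (d:ℝ) * μ) = B * μ / ε := by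
      calc _ = (ε ^ (-(d:ℝ)) * ε ^ (d:ℝ)) * (B * μ / ε) := by ring
        _ = _ := by rw [hcan, one_mul]
    rw [e1, e2]
    ring
  · intro y hy y' hy'
    by_cases hyy : y = y'
    · subst hyy
      simp [hp0]
    have hsh := box_shift d (fun u => ‖v (u + (y' - y)) t - v u t‖ₑ ^ p) (fun i x => by
      have : x + EuclideanSpace.single i 1 + (y' - y) = x + (y' - y) + EuclideanSpace.single i 1 := by
        abel
      simp only [this, hper]) (-y')
    have hsh2 : ∫⁻ x in Box d, ‖v (x - y) t - v (x - y') t‖ₑ ^ p =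
        ∫⁻ x in Box d, ‖v (x + (y' - y)) t - v x t‖ₑ ^ p := by
      rw [← hsh]
      refine lintegral_congr fun x => ?_
      have : x + -y' + (y' - y) = x - y := by abel
      rw [this, ← sub_eq_add_neg]
    rw [hsh2]
    refine (hconv _ _ (hdiff (y' - y) (sub_ne_zero.2 (Ne.symm hyy)))).trans ?_
    rw [ENNReal.ofReal_mul (by positivity)]
    gcongr
    calc ‖y' - y‖ ≤ ‖y'‖ + ‖y‖ := norm_sub_le _ _
      _ ≤ 2 * ε := by linarith [K8 y hy, K8 y' hy']

/-- for `v ∈ L^p_t(B^θ_{p,∞}(𝕋^d))`, `p ≥ 3`, the approximate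
Duchon–Robert dissipation satisfies `‖R_ε : ∇v_ε‖_{L^{p/3}_{x,t}} ≤ C ε^{3θ−1} ‖v‖³`;
in particular for `θ > 1/3` it tends to `0` in `L^{p/3}_{x,t}` as `ε → 0`. -/
theorem stmt13 (d : ℕ) (ρ : EuclideanSpace ℝ (Fin d) → ℝ)
    (hρ_smooth : ContDiff ℝ (⊤ : ℕ∞) ρ)
    (hρ_nonneg : ∀ y, 0 ≤ ρ y)
    (hρ_supp : Function.support ρ ⊆ Metric.ball 0 1)
    (hρ_int : ∫ y, ρ y = 1)
    (T p θ : ℝ) (hT : 0 < T) (hp : 3 ≤ p) (hθ : θ ∈ Ioo (0:ℝ) 1) :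
    ∃ C > 0, ∀ (v : EuclideanSpace ℝ (Fin d) → ℝ → EuclideanSpace ℝ (Fin d))
      (b : ℝ → ℝ) (N : ℝ), 0 ≤ N →
      (∀ (i : Fin d) (x : EuclideanSpace ℝ (Fin d)) (t : ℝ),
        v (x + EuclideanSpace.single i 1) t = v x t) →
      (∀ t ∈ Ioo (0:ℝ) T,
        eLpNorm (fun x => v x t) (ENNReal.ofReal p) (volume.restrict (Box d))
          ≤ ENNReal.ofReal (b t)) →
      (∀ t ∈ Ioo (0:ℝ) T, ∀ h : EuclideanSpace ℝ (Fin d), h ≠ 0 →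
        eLpNorm (fun x => v (x + h) t - v x t) (ENNReal.ofReal p) (volume.restrict (Box d))
          ≤ ENNReal.ofReal (‖h‖ ^ θ * b t)) →
      eLpNorm b (ENNReal.ofReal p) (volume.restrict (Ioo (0:ℝ) T)) ≤ ENNReal.ofReal N →
      (∀ ε : ℝ, 0 < ε →
        eLpNorm (fun z : EuclideanSpace ℝ (Fin d) × ℝ => DRapprox d ρ ε v z.1 z.2)
            (ENNReal.ofReal (p / 3)) (volume.restrict (Box d ×ˢ Ioo (0:ℝ) T))
          ≤ ENNReal.ofReal (C * ε ^ (3 * θ - 1) * N ^ 3))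
      ∧ (θ > 1/3 →
          Tendsto (fun ε : ℝ =>
              eLpNorm (fun z : EuclideanSpace ℝ (Fin d) × ℝ => DRapprox d ρ ε v z.1 z.2)
                (ENNReal.ofReal (p / 3)) (volume.restrict (Box d ×ˢ Ioo (0:ℝ) T)))
            (𝓝[>] (0:ℝ)) (𝓝 0)) := by
  obtain ⟨κ, hκ, H⟩ := slice_final d ρ hρ_smooth hρ_nonneg hρ_supp hρ_int p θ hp hθ.1
  have hp0 : 0 < p := by linarith
  refine ⟨κ * 2 ^ (3 * θ) + 1, by positivity, ?_⟩
  intro v b N hN hper hb hdiff hbN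
  have main : ∀ ε : ℝ, 0 < ε →
        eLpNorm (fun z : EuclideanSpace ℝ (Fin d) × ℝ => DRapprox d ρ ε v z.1 z.2)
            (ENNReal.ofReal (p / 3)) (volume.restrict (Box d ×ˢ Ioo (0:ℝ) T))
          ≤ ENNReal.ofReal ((κ * 2 ^ (3 * θ) + 1) * ε ^ (3 * θ - 1) * N ^ 3) := by
    intro ε hε
    have hbN' : ∫⁻ t in Ioo (0:ℝ) T, ENNReal.ofReal (b t) ^ p ≤ ENNReal.ofReal N ^ p := by
      rw [eLpNorm_eq_lintegral_rpow_enorm_toReal (by simpa using hp0) (by simp),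
        ENNReal.toReal_ofReal hp0.le] at hbN
      have := ENNReal.rpow_le_rpow hbN hp0.le
      rw [← ENNReal.rpow_mul, one_div_mul_cancel hp0.ne', ENNReal.rpow_one] at this
      refine le_trans (lintegral_mono fun t => ?_) this
      gcongr
      exact Real.ofReal_le_enorm (b t)
    have hprod : (volume.restrict (Box d ×ˢ Ioo (0:ℝ) T) :
        Measure (EuclideanSpace ℝ (Fin d) × ℝ)) =
        (volume.restrict (Box d)).prod (volume.restrict (Ioo (0:ℝ) T)) := by
      rw [Measure.prod_restrict, Measure.volume_eq_prod]
    set Q : ℝ≥0∞ := ENNReal.ofReal (κ / ε) ^ (p / 3) * ENNReal.ofReal ((2 * ε) ^ θ) ^ p with hQ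
    have hQt : Q ≠ ∞ := ENNReal.mul_ne_top
      (ENNReal.rpow_ne_top_of_nonneg (by positivity) ENNReal.ofReal_ne_top)
      (ENNReal.rpow_ne_top_of_nonneg hp0.le ENNReal.ofReal_ne_top)
    have hI : ∫⁻ z, ‖DRapprox d ρ ε v z.1 z.2‖ₑ ^ (p / 3)
        ∂((volume.restrict (Box d)).prod (volume.restrict (Ioo (0:ℝ) T))) ≤
        Q * ENNReal.ofReal N ^ p := by
      rw [← lintegral_prod_swap]
      refine (lintegral_prod_le _).trans ?_
      simp only [Prod.swap_prod_mk]
      calc _ ≤ ∫⁻ t in Ioo (0:ℝ) T, Q * ENNReal.ofReal (b t) ^ p := by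
            refine setLIntegral_mono_ae' measurableSet_Ioo (ae_of_all _ fun t ht => ?_)
            exact H v t (b t) (fun i x => hper i x t) (hb t ht) (hdiff t ht) ε hε
        _ = Q * ∫⁻ t in Ioo (0:ℝ) T, ENNReal.ofReal (b t) ^ p := lintegral_const_mul' _ _ hQt
        _ ≤ _ := by gcongr
    rw [eLpNorm_eq_lintegral_rpow_enorm_toReal (by simpa using hp0) (by simp),
        ENNReal.toReal_ofReal (by positivity), hprod]
    calc _ ≤ (Q * ENNReal.ofReal N ^ p) ^ (1 / (p / 3)) := by gcongr
      _ = ENNReal.ofReal (κ / ε) * ENNReal.ofReal ((2 * ε) ^ θ) ^ 3 * ENNReal.ofReal N ^ 3 := by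
        have h1 : p / 3 * (1 / (p / 3)) = 1 := by field_simp
        have h2 : p * (1 / (p / 3)) = ((3 : ℕ) : ℝ) := by field_simp; norm_num
        have h0 : 0 ≤ 1 / (p / 3) := by positivity
        rw [hQ, ENNReal.mul_rpow_of_nonneg _ _ h0, ENNReal.mul_rpow_of_nonneg _ _ h0,
          ← ENNReal.rpow_mul, ← ENNReal.rpow_mul, ← ENNReal.rpow_mul, h1, h2,
          ENNReal.rpow_one, ENNReal.rpow_natCast, ENNReal.rpow_natCast]
      _ = ENNReal.ofReal (κ / ε * ((2 * ε) ^ θ) ^ 3 * N ^ 3) := by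
        rw [ENNReal.ofReal_mul (by positivity), ENNReal.ofReal_mul (by positivity),
          ENNReal.ofReal_pow (by positivity), ENNReal.ofReal_pow hN]
      _ ≤ _ := by
        apply ENNReal.ofReal_le_ofReal
        have e1 : κ / ε * ((2 * ε) ^ θ) ^ 3 = κ * 2 ^ (3 * θ) * ε ^ (3 * θ - 1) := by
          rw [← Real.rpow_natCast, ← Real.rpow_mul (by positivity),
            Real.mul_rpow (by norm_num) hε.le, Real.rpow_sub hε, Real.rpow_one]
          have : θ * ((3:ℕ):ℝ) = 3 * θ := by push_cast; ring
          rw [this]; ring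
        rw [e1]
        have : 0 < ε ^ (3 * θ - 1) := Real.rpow_pos_of_pos hε _
        gcongr
        linarith
  refine ⟨main, fun hθ3 => ?_⟩
  have hlim : Tendsto (fun ε : ℝ =>
      ENNReal.ofReal ((κ * 2 ^ (3 * θ) + 1) * ε ^ (3 * θ - 1) * N ^ 3)) (𝓝[>] (0:ℝ)) (𝓝 0) := by
    have hpos : 0 < 3 * θ - 1 := by linarith
    have h1 : Tendsto (fun ε : ℝ => (κ * 2 ^ (3 * θ) + 1) * ε ^ (3 * θ - 1) * N ^ 3)
        (𝓝 0) (𝓝 ((κ * 2 ^ (3 * θ) + 1) * (0:ℝ) ^ (3 * θ - 1) * N ^ 3)) :=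
      ((Real.continuousAt_rpow_const 0 _ (Or.inr hpos.le)).tendsto.const_mul _).mul_const _
    rw [Real.zero_rpow hpos.ne', mul_zero, zero_mul] at h1
    have h2 := (ENNReal.tendsto_ofReal h1).mono_left (nhdsWithin_le_nhds (s := Ioi 0))
    simpa using h2
  refine tendsto_of_tendsto_of_tendsto_of_le_of_le' tendsto_const_nhds hlim
    (Eventually.of_forall fun _ => zero_le) ?_
  filter_upwards [self_mem_nhdsWithin] with ε hε
  exact main ε hε
end
end
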